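/- Let n ≥ 1 and k ≥ 3 be natural numbers, and let F be the free group on generators c_{i,l} indexed by integers 1 ≤ i ≤ 2n and 1 ≤ l ≤ k−1. For 1 ≤ j ≤ n and 1 ≤ l ≤ k−1 set w_{j,l} = c_{2n,l} · c_{2n−2,l} ⋯ c_{2j+2,l} · c_{2j,l} (the product of the even-index generators with second index l, taken with first index descending from 2n to 2j). For 2 ≤ l ≤ k−2 define δ_{1,l} = c_{1,l}⁻¹ · w_{1,l−1} · c_{1,l−1} · w_{1,l−1}⁻¹, and recursively for 2 ≤ i ≤ n define δ_{i,l} = c_{2i−1,l}⁻¹ · δ_{i−1,l} · w_{i,l−1} · c_{2i−1,l−1} · w_{i,l−1}⁻¹. Let N be the normal closure in F of the set consisting of: all c_{2i,l} with 1 ≤ i ≤ n and 1 ≤ l ≤ k−1; all c_{2i−1,1} and all c_{2i−1,k−1} with 1 ≤ i ≤ n; all δ_{1,l} with 2 ≤ l ≤ k−2; and all δ_{i−1,l} · δ_{i,l}⁻¹ with 2 ≤ i ≤ n and 2 ≤ l ≤ k−2. Then N = F; equivalently, every generator c_{i,l} lies in N, i.e. the quotient group F/N is trivial. -/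

import Mathlib

/-- The generator `c_{i,l}` of the free group on the symbols `(i, l)`. -/
def genC (i l : ℕ) : FreeGroup (ℕ × ℕ) := FreeGroup.of (i, l)

/-- The word `w_{j,l} = c_{2n,l} · c_{2n−2,l} ⋯ c_{2j+2,l} · c_{2j,l}`, the product of the
even-index generators with second index `l`, first index descending from `2n` to `2j`. -/
def wordW (n j l : ℕ) : FreeGroup (ℕ × ℕ) :=
  ((List.range (n - j + 1)).map (fun t => genC (2 * n - 2 * t) l)).prod

/-- The recursively defined elements `δ_{i,l}`:
`δ_{1,l} = c_{1,l}⁻¹ · w_{1,l−1} · c_{1,l−1} · w_{1,l−1}⁻¹` and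
`δ_{i,l} = c_{2i−1,l}⁻¹ · δ_{i−1,l} · w_{i,l−1} · c_{2i−1,l−1} · w_{i,l−1}⁻¹` for `i ≥ 2`. -/
def wordDelta (n : ℕ) : ℕ → ℕ → FreeGroup (ℕ × ℕ)
  | 0, _ => 1
  | 1, l => (genC 1 l)⁻¹ * wordW n 1 (l - 1) * genC 1 (l - 1) * (wordW n 1 (l - 1))⁻¹
  | (i + 2), l =>
      (genC (2 * (i + 2) - 1) l)⁻¹ * wordDelta n (i + 1) l * wordW n (i + 2) (l - 1) *
        genC (2 * (i + 2) - 1) (l - 1) * (wordW n (i + 2) (l - 1))⁻¹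

/-- The relator set: all `c_{2i,l}` (`1 ≤ i ≤ n`, `1 ≤ l ≤ k−1`), all `c_{2i−1,1}` and
`c_{2i−1,k−1}` (`1 ≤ i ≤ n`), all `δ_{1,l}` (`2 ≤ l ≤ k−2`), and all `δ_{i−1,l} · δ_{i,l}⁻¹`
(`2 ≤ i ≤ n`, `2 ≤ l ≤ k−2`). -/
def relatorSet (n k : ℕ) : Set (FreeGroup (ℕ × ℕ)) :=
  {x | ∃ i l, 1 ≤ i ∧ i ≤ n ∧ 1 ≤ l ∧ l ≤ k - 1 ∧ x = genC (2 * i) l} ∪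
  {x | ∃ i, 1 ≤ i ∧ i ≤ n ∧ x = genC (2 * i - 1) 1} ∪
  {x | ∃ i, 1 ≤ i ∧ i ≤ n ∧ x = genC (2 * i - 1) (k - 1)} ∪
  {x | ∃ l, 2 ≤ l ∧ l ≤ k - 2 ∧ x = wordDelta n 1 l} ∪
  {x | ∃ i l, 2 ≤ i ∧ i ≤ n ∧ 2 ≤ l ∧ l ≤ k - 2 ∧
        x = wordDelta n (i - 1) l * (wordDelta n i l)⁻¹}

theorem wordDelta_succ (n i l : ℕ) :
    wordDelta n (i + 1) l =
      (genC (2 * (i + 1) - 1) l)⁻¹ * wordDelta n i l * wordW n (i + 1) (l - 1) *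
        genC (2 * (i + 1) - 1) (l - 1) * (wordW n (i + 1) (l - 1))⁻¹ := by
  cases i with
  | zero => simp [wordDelta]
  | succ i => rfl

theorem genC_even_mem {n k i l : ℕ} (hi : 1 ≤ i) (hin : i ≤ n) (hl : 1 ≤ l) (hlk : l ≤ k - 1) :
    genC (2 * i) l ∈ Subgroup.normalClosure (relatorSet n k) :=
  Subgroup.subset_normalClosure <| .inl <| .inl <| .inl <| .inl ⟨i, l, hi, hin, hl, hlk, rfl⟩

theorem wordW_mem {n k j l : ℕ} (hj : 1 ≤ j) (hjn : j ≤ n) (hl : 1 ≤ l) (hlk : l ≤ k - 1) :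
    wordW n j l ∈ Subgroup.normalClosure (relatorSet n k) := by
  refine Subgroup.list_prod_mem _ fun x hx => ?_
  obtain ⟨t, ht, rfl⟩ := List.mem_map.mp hx
  rw [List.mem_range] at ht
  rw [← Nat.mul_sub]
  exact genC_even_mem (by omega) (by omega) hl hlk

theorem wordDelta_mem {n k l : ℕ} (hl : 2 ≤ l) (hlk : l ≤ k - 2) (i : ℕ) (hin : i ≤ n) :
    wordDelta n i l ∈ Subgroup.normalClosure (relatorSet n k) := by
  induction i with
  | zero => exact one_mem _
  | succ i ih =>
    rcases Nat.eq_zero_or_pos i with rfl | hi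
    · exact Subgroup.subset_normalClosure <| .inl <| .inr ⟨l, hl, hlk, rfl⟩
    · have h : wordDelta n i l * (wordDelta n (i + 1) l)⁻¹ ∈
          Subgroup.normalClosure (relatorSet n k) :=
        Subgroup.subset_normalClosure <| .inr ⟨i + 1, l, by omega, hin, hl, hlk, rfl⟩
      exact inv_mem_iff.mp ((Subgroup.mul_mem_cancel_left _ (ih (by omega))).mp h)

theorem genC_odd_mem {n k i l : ℕ} (hin : i + 1 ≤ n) (hl : 1 ≤ l) (hlk : l ≤ k - 1) :
    genC (2 * (i + 1) - 1) l ∈ Subgroup.normalClosure (relatorSet n k) := by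
  induction l, hl using Nat.le_induction with
  | base =>
    exact Subgroup.subset_normalClosure <| .inl <| .inl <| .inl <| .inr
      ⟨i + 1, by omega, hin, rfl⟩
  | succ l hl ih =>
    rcases Nat.eq_or_lt_of_le hlk with h | h
    · rw [h]
      exact Subgroup.subset_normalClosure <| .inl <| .inl <| .inr ⟨i + 1, by omega, hin, rfl⟩
    · have hδ := wordDelta_mem (n := n) (k := k) (l := l + 1) (by omega) (by omega)
      have hw := wordW_mem (n := n) (k := k) (j := i + 1) (l := l) (by omega) hin hl (by omega)
      have hc := ih (by omega)
      have hmem := hδ (i + 1) hin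
      rwa [wordDelta_succ, Nat.add_sub_cancel, Subgroup.mul_mem_cancel_right _ (inv_mem hw),
        Subgroup.mul_mem_cancel_right _ hc, Subgroup.mul_mem_cancel_right _ hw,
        Subgroup.mul_mem_cancel_right _ (hδ i (by omega)), inv_mem_iff] at hmem

/-- Every generator `c_{i,l}` (`1 ≤ i ≤ 2n`, `1 ≤ l ≤ k−1`) lies in the normal closure `N`
of the relator set; equivalently, the quotient of the free group on these generators by `N`
is trivial. -/
theorem normalClosure_relators_eq_top (n k : ℕ) (hn : 1 ≤ n) (hk : 3 ≤ k) :
    ∀ i l : ℕ, 1 ≤ i → i ≤ 2 * n → 1 ≤ l → l ≤ k - 1 →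
      genC i l ∈ Subgroup.normalClosure (relatorSet n k) := by
  intro i l hi hin hl hlk
  obtain ⟨j, rfl | rfl⟩ := Nat.even_or_odd' i
  · exact genC_even_mem (by omega) (by omega) hl hlk
  · exact genC_odd_mem (i := j) (by omega) hl hlk
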